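/- For every natural number n ≥ 1, there exists a continuous section of f_n(ℝ²) whose image is contained in W_∞, i.e. an 'adding a point at infinity' section exists. -/

import Mathlib

/-- The ordered configuration space of `n` points in `S`. -/
abbrev PConf (n : ℕ) (S : Type*) : Type _ := {x : Fin n → S // Function.Injective x}

/-- The forgetful map `f_n(S)` forgetting the 0th point. -/
def forgetPoint (n : ℕ) {S : Type*} (x : PConf (n + 1) S) : PConf n S :=
  ⟨x.1 ∘ Fin.succ, x.2.comp (Fin.succ_injective n)⟩

/-- The set `W_∞`: configurations where the 0th point has larger norm than all others. -/
def Winfty (n : ℕ) (x : PConf (n + 1) (EuclideanSpace ℝ (Fin 2))) : Prop :=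
  ∀ i : Fin (n + 1), i ≠ 0 → ‖x.1 i‖ < ‖x.1 0‖

/-- A point of the plane on the first coordinate axis, at distance `1 + ∑ ‖x i‖` from the origin. -/
noncomputable def farPoint {n : ℕ} (x : Fin n → EuclideanSpace ℝ (Fin 2)) :
    EuclideanSpace ℝ (Fin 2) :=
  (1 + ∑ i, ‖x i‖) • EuclideanSpace.single 0 1

theorem continuous_farPoint {n : ℕ} :
    Continuous (farPoint : (Fin n → EuclideanSpace ℝ (Fin 2)) → EuclideanSpace ℝ (Fin 2)) := by
  unfold farPoint
  fun_prop

theorem norm_lt_norm_farPoint {n : ℕ} (x : Fin n → EuclideanSpace ℝ (Fin 2)) (i : Fin n) :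
    ‖x i‖ < ‖farPoint x‖ := by
  have hle : ‖x i‖ ≤ ∑ j, ‖x j‖ :=
    Finset.single_le_sum (f := fun j => ‖x j‖) (fun j _ => norm_nonneg _) (Finset.mem_univ i)
  have hpos : 0 ≤ 1 + ∑ j, ‖x j‖ := by positivity
  have hnorm : ‖farPoint x‖ = 1 + ∑ j, ‖x j‖ := by
    simp [farPoint, norm_smul, abs_of_nonneg hpos]
  linarith

theorem section_at_infinity_exists_R2 (n : ℕ) (hn : 1 ≤ n) :
    ∃ s : PConf n (EuclideanSpace ℝ (Fin 2)) → PConf (n + 1) (EuclideanSpace ℝ (Fin 2)),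
      Continuous s ∧ (∀ x, forgetPoint n (s x) = x) ∧ ∀ x, Winfty n (s x) := by
  refine ⟨fun x => ⟨Fin.cons (farPoint x.1) x.1, Fin.cons_injective_iff.2 ⟨?_, x.2⟩⟩, ?_, ?_, ?_⟩
  · rintro ⟨i, hi⟩
    exact (norm_lt_norm_farPoint x.1 i).ne (congrArg norm hi)
  · refine Continuous.subtype_mk (continuous_pi fun i => ?_) _
    refine Fin.cases ?_ (fun j => ?_) i
    · exact continuous_farPoint.comp continuous_subtype_val
    · exact (continuous_apply j).comp continuous_subtype_val
  · exact fun x => Subtype.ext (funext fun i => rfl)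
  · intro x i hi
    obtain ⟨j, rfl⟩ := Fin.exists_succ_eq.2 hi
    exact norm_lt_norm_farPoint x.1 j
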